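/- Let A ∈ ℝ^{n×n}, B ∈ ℝ^{n×p}, C ∈ ℝ^{m×n}, D ∈ ℝ^{m×p}, Q ∈ ℝ^{m×m} symmetric with −Q positive definite, R ∈ ℝ^{p×p} symmetric, S ∈ ℝ^{m×p}, and P ∈ ℝ^{n×n} symmetric positive definite. Suppose that for every continuous u : ℝ → ℝᵖ, every differentiable x : ℝ → ℝⁿ with x′(t) = A x(t) + B u(t) for all t, with y(t) := C x(t) + D u(t), and all t₀ ≤ t₁, the dissipation inequality x(t₁)ᵀPx(t₁) − x(t₀)ᵀPx(t₀) ≤ ∫_{t₀}^{t₁} ( y(t)ᵀQ y(t) + 2 y(t)ᵀ S u(t) + u(t)ᵀ R u(t) ) dt holds. Then the symmetric block matrix [ −AᵀP − PA , −PB + CᵀS , Cᵀ ; −BᵀP + SᵀC , DᵀS + SᵀD + R , Dᵀ ; C , D , −Q⁻¹ ] is positive semidefinite. -/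

import Mathlib

open Matrix intervalIntegral

/-- The symmetric 3×3 block matrix
`[ -AᵀP - PA , -PB + CᵀS , Cᵀ ; -BᵀP + SᵀC , DᵀS + SᵀD + R , Dᵀ ; C , D , -Q⁻¹ ]`
appearing in the `(Q,S,R)`-dissipativity LMI. -/
noncomputable def dissipativityLMI {n p m : ℕ}
    (A : Matrix (Fin n) (Fin n) ℝ) (B : Matrix (Fin n) (Fin p) ℝ)
    (C : Matrix (Fin m) (Fin n) ℝ) (D : Matrix (Fin m) (Fin p) ℝ)
    (Q : Matrix (Fin m) (Fin m) ℝ) (S : Matrix (Fin m) (Fin p) ℝ)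
    (R : Matrix (Fin p) (Fin p) ℝ) (P : Matrix (Fin n) (Fin n) ℝ) :
    Matrix (Fin n ⊕ Fin p ⊕ Fin m) (Fin n ⊕ Fin p ⊕ Fin m) ℝ :=
  Matrix.of fun i j =>
    match i, j with
    | Sum.inl a, Sum.inl b => (-(Aᵀ * P) - P * A) a b
    | Sum.inl a, Sum.inr (Sum.inl b) => (-(P * B) + Cᵀ * S) a b
    | Sum.inl a, Sum.inr (Sum.inr b) => Cᵀ a b
    | Sum.inr (Sum.inl a), Sum.inl b => (-(Bᵀ * P) + Sᵀ * C) a b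
    | Sum.inr (Sum.inl a), Sum.inr (Sum.inl b) => (Dᵀ * S + Sᵀ * D + R) a b
    | Sum.inr (Sum.inl a), Sum.inr (Sum.inr b) => Dᵀ a b
    | Sum.inr (Sum.inr a), Sum.inl b => C a b
    | Sum.inr (Sum.inr a), Sum.inr (Sum.inl b) => D a b
    | Sum.inr (Sum.inr a), Sum.inr (Sum.inr b) => (-(Q⁻¹)) a b


/-- The quadratic form of `dissipativityLMI`, expanded blockwise. -/
theorem dotProduct_dissipativityLMI_mulVec {n p m : ℕ}
    (A : Matrix (Fin n) (Fin n) ℝ) (B : Matrix (Fin n) (Fin p) ℝ)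
    (C : Matrix (Fin m) (Fin n) ℝ) (D : Matrix (Fin m) (Fin p) ℝ)
    (Q : Matrix (Fin m) (Fin m) ℝ) (S : Matrix (Fin m) (Fin p) ℝ)
    (R : Matrix (Fin p) (Fin p) ℝ) (P : Matrix (Fin n) (Fin n) ℝ)
    (x : Fin n → ℝ) (u : Fin p → ℝ) (z : Fin m → ℝ) :
    Sum.elim x (Sum.elim u z) ⬝ᵥ
        dissipativityLMI A B C D Q S R P *ᵥ Sum.elim x (Sum.elim u z) =
      -((A *ᵥ x + B *ᵥ u) ⬝ᵥ P *ᵥ x) - x ⬝ᵥ P *ᵥ (A *ᵥ x + B *ᵥ u) +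
        2 * ((C *ᵥ x + D *ᵥ u) ⬝ᵥ S *ᵥ u) + u ⬝ᵥ R *ᵥ u +
        2 * (z ⬝ᵥ (C *ᵥ x + D *ᵥ u)) - z ⬝ᵥ Q⁻¹ *ᵥ z := by
  have h : dissipativityLMI A B C D Q S R P *ᵥ Sum.elim x (Sum.elim u z) =
      Sum.elim
        ((-(Aᵀ * P) - P * A) *ᵥ x + ((-(P * B) + Cᵀ * S) *ᵥ u + Cᵀ *ᵥ z))
        (Sum.elim
          ((-(Bᵀ * P) + Sᵀ * C) *ᵥ x + ((Dᵀ * S + Sᵀ * D + R) *ᵥ u + Dᵀ *ᵥ z))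
          (C *ᵥ x + (D *ᵥ u + (-(Q⁻¹)) *ᵥ z))) := by
    ext i
    rcases i with i | i | i <;>
      simp only [mulVec, dotProduct, Fintype.sum_sum_type, Sum.elim_inl, Sum.elim_inr,
        dissipativityLMI, of_apply, Pi.add_apply]
  have ht {k l : ℕ} (M : Matrix (Fin k) (Fin l) ℝ) (v : Fin l → ℝ) (w : Fin k → ℝ) :
      v ⬝ᵥ Mᵀ *ᵥ w = (M *ᵥ v) ⬝ᵥ w := by
    rw [dotProduct_mulVec, vecMul_transpose]
  rw [h, sumElim_dotProduct_sumElim, sumElim_dotProduct_sumElim]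
  simp only [add_mulVec, sub_mulVec, neg_mulVec, ← mulVec_mulVec, dotProduct_add,
    dotProduct_sub, dotProduct_neg, add_dotProduct, mulVec_add, ht]
  rw [dotProduct_comm (S *ᵥ u) (C *ᵥ x), dotProduct_comm (S *ᵥ u) (D *ᵥ u),
    dotProduct_comm (C *ᵥ x) z, dotProduct_comm (D *ᵥ u) z]
  ring

/-- The matrix `dissipativityLMI` is symmetric. -/
theorem dissipativityLMI_isHermitian {n p m : ℕ}
    (A : Matrix (Fin n) (Fin n) ℝ) (B : Matrix (Fin n) (Fin p) ℝ)
    (C : Matrix (Fin m) (Fin n) ℝ) (D : Matrix (Fin m) (Fin p) ℝ)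
    {Q : Matrix (Fin m) (Fin m) ℝ} (S : Matrix (Fin m) (Fin p) ℝ)
    {R : Matrix (Fin p) (Fin p) ℝ} {P : Matrix (Fin n) (Fin n) ℝ}
    (hQ : Q.IsSymm) (hR : R.IsSymm) (hP : P.IsSymm) :
    (dissipativityLMI A B C D Q S R P).IsHermitian := by
  have hxx : (-(Aᵀ * P) - P * A)ᵀ = -(Aᵀ * P) - P * A := by
    simp only [transpose_sub, transpose_neg, transpose_mul, transpose_transpose, hP.eq]
    abel
  have hxu : (-(P * B) + Cᵀ * S)ᵀ = -(Bᵀ * P) + Sᵀ * C := by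
    simp only [transpose_add, transpose_neg, transpose_mul, transpose_transpose, hP.eq]
  have huu : (Dᵀ * S + Sᵀ * D + R)ᵀ = Dᵀ * S + Sᵀ * D + R := by
    simp only [transpose_add, transpose_mul, transpose_transpose, hR.eq]
    abel
  have hzz : (-(Q⁻¹))ᵀ = -(Q⁻¹) := by
    rw [transpose_neg, transpose_nonsing_inv, hQ.eq]
  ext i j
  rcases i with i | i | i <;> rcases j with j | j | j
  · exact congrFun₂ hxx i j
  · exact (congrFun₂ hxu j i).symm
  · rfl
  · exact congrFun₂ hxu i j
  · exact congrFun₂ huu i j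
  · rfl
  · rfl
  · rfl
  · exact congrFun₂ hzz i j

/-- Through every pair of an initial state and an initial input value there passes a trajectory of
`ẋ = Ax + Bu` with continuous input. -/
theorem exists_trajectory {n p : ℕ} (A : Matrix (Fin n) (Fin n) ℝ)
    (B : Matrix (Fin n) (Fin p) ℝ) (x₀ : Fin n → ℝ) (u₀ : Fin p → ℝ) :
    ∃ (u : ℝ → Fin p → ℝ) (x : ℝ → Fin n → ℝ), Continuous u ∧ u 0 = u₀ ∧ x 0 = x₀ ∧
      ∀ t, HasDerivAt x (A *ᵥ x t + B *ᵥ u t) t := by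
  let E := (Fin n → ℝ) × (Fin p → ℝ)
  let L : E →L[ℝ] E := LinearMap.toContinuousLinearMap
    ((A.mulVecLin.coprod B.mulVecLin).prod 0)
  let z : ℝ → E := fun t => NormedSpace.exp (t • L) (x₀, u₀)
  have hz (t : ℝ) : HasDerivAt z (L (z t)) t :=
    (hasDerivAt_exp_smul_const' L t).clm_apply (hasDerivAt_const t (x₀, u₀)) |>.congr_deriv
      (by simp [z])
  have hz0 : z 0 = (x₀, u₀) := by simp [z]
  have hzc : Continuous z := continuous_iff_continuousAt.2 fun t => (hz t).continuousAt
  refine ⟨fun t => (z t).2, fun t => (z t).1, hzc.snd, by simp [hz0], by simp [hz0],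
    fun t => ?_⟩
  exact (hz t).hasFDerivAt.fst.hasDerivAt.congr_deriv (by simp [L]; rfl)

/-- Product rule for the quadratic form of a matrix along a differentiable curve. -/
theorem HasDerivAt.dotProduct_mulVec_self {n : ℕ} (P : Matrix (Fin n) (Fin n) ℝ)
    {x : ℝ → Fin n → ℝ} {x' : Fin n → ℝ} {t : ℝ} (hx : HasDerivAt x x' t) :
    HasDerivAt (fun s => x s ⬝ᵥ P *ᵥ x s) (x' ⬝ᵥ P *ᵥ x t + x t ⬝ᵥ P *ᵥ x') t := by
  have hP : HasDerivAt (fun s => P *ᵥ x s) (P *ᵥ x') t :=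
    (LinearMap.toContinuousLinearMap P.mulVecLin).hasFDerivAt.comp_hasDerivAt t hx
  rw [hasDerivAt_pi] at hx hP
  simp only [dotProduct, ← Finset.sum_add_distrib]
  exact HasDerivAt.fun_sum fun i _ => (hx i).fun_mul (hP i)

/-- A dissipation inequality along a trajectory yields its differential form at the
initial time. -/
theorem deriv_le_of_sub_le_integral {V w : ℝ → ℝ} {V' t₀ : ℝ} (hV : HasDerivAt V V' t₀)
    (hw : Continuous w) (h : ∀ t, t₀ ≤ t → V t - V t₀ ≤ ∫ s in t₀..t, w s) : V' ≤ w t₀ := by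
  have hd := hV.sub (integral_hasDerivAt_right (hw.intervalIntegrable t₀ t₀)
    hw.aestronglyMeasurable.stronglyMeasurableAtFilter hw.continuousAt)
  have hlim := hd.tendsto_slope_zero_right
  refine sub_nonpos.1 (le_of_tendsto hlim ?_)
  filter_upwards [self_mem_nhdsWithin] with t ht
  have ht' : 0 < t := ht
  have := h (t₀ + t) (by linarith)
  refine mul_nonpos_of_nonneg_of_nonpos (inv_nonneg.2 ht'.le) ?_
  simp only [Pi.sub_apply, integral_same]
  linarith

/-- If the system `ẋ = Ax + Bu, y = Cx + Du` is `(Q,S,R)`-dissipative from `u` to `y`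
with storage function `V(x) = xᵀPx`, then the `(Q,S,R)`-dissipativity LMI holds. -/
theorem LMI_of_dissipativity (n p m : ℕ)
    (A : Matrix (Fin n) (Fin n) ℝ) (B : Matrix (Fin n) (Fin p) ℝ)
    (C : Matrix (Fin m) (Fin n) ℝ) (D : Matrix (Fin m) (Fin p) ℝ)
    (Q : Matrix (Fin m) (Fin m) ℝ) (S : Matrix (Fin m) (Fin p) ℝ)
    (R : Matrix (Fin p) (Fin p) ℝ) (P : Matrix (Fin n) (Fin n) ℝ)
    (hQ : Q.IsSymm) (hQneg : (-Q).PosDef) (hR : R.IsSymm) (hP : P.PosDef)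
    (hdiss : ∀ u : ℝ → (Fin p → ℝ), Continuous u →
      ∀ x : ℝ → (Fin n → ℝ),
        (∀ t : ℝ, HasDerivAt x (A.mulVec (x t) + B.mulVec (u t)) t) →
        ∀ t₀ t₁ : ℝ, t₀ ≤ t₁ →
          x t₁ ⬝ᵥ P.mulVec (x t₁) - x t₀ ⬝ᵥ P.mulVec (x t₀) ≤
            ∫ t in t₀..t₁,
              ((C.mulVec (x t) + D.mulVec (u t)) ⬝ᵥ
                  Q.mulVec (C.mulVec (x t) + D.mulVec (u t)) +
                2 * ((C.mulVec (x t) + D.mulVec (u t)) ⬝ᵥ S.mulVec (u t)) +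
                u t ⬝ᵥ R.mulVec (u t))) :
    (dissipativityLMI A B C D Q S R P).PosSemidef := by
  have hPs : P.IsSymm := by simpa using hP.isHermitian
  refine .of_dotProduct_mulVec_nonneg (dissipativityLMI_isHermitian A B C D S hQ hR hPs)
    fun v => ?_
  obtain ⟨x₀, u₀, z, rfl⟩ : ∃ x₀ u₀ z, v = Sum.elim x₀ (Sum.elim u₀ z) :=
    ⟨fun i => v (.inl i), fun i => v (.inr (.inl i)), fun i => v (.inr (.inr i)), by
      ext (i | i | i) <;> rfl⟩
  rw [star_trivial, dotProduct_dissipativityLMI_mulVec]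
  obtain ⟨u, x, hu, hu0, hx0, hx⟩ := exists_trajectory A B x₀ u₀
  have hxc : Continuous x := continuous_iff_continuousAt.2 fun t => (hx t).continuousAt
  have hle := deriv_le_of_sub_le_integral ((hx 0).dotProduct_mulVec_self P) (by fun_prop)
    fun t ht => hdiss u hu x hx 0 t ht
  simp only [hu0, hx0] at hle
  set y := C *ᵥ x₀ + D *ᵥ u₀
  have hsq := hQneg.posSemidef.dotProduct_mulVec_nonneg (y - Q⁻¹ *ᵥ z)
  have hdet : IsUnit Q.det := (isUnit_iff_isUnit_det Q).1 (by simpa using hQneg.isUnit)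
  have hQQ : Q *ᵥ Q⁻¹ *ᵥ z = z := by
    rw [mulVec_mulVec, mul_nonsing_inv Q hdet, one_mulVec]
  have hcross : (Q⁻¹ *ᵥ z) ⬝ᵥ Q *ᵥ y = z ⬝ᵥ y := by
    rw [dotProduct_mulVec, ← mulVec_transpose, hQ.eq, hQQ]
  simp only [star_trivial, neg_mulVec, mulVec_sub, hQQ, dotProduct_neg, dotProduct_sub,
    sub_dotProduct, hcross, dotProduct_comm y z, dotProduct_comm (Q⁻¹ *ᵥ z) z] at hsq
  linarith
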